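/- arXiv:1506.08875 — 2 statements merged into one kernel-verified Lean document; each statement's English description precedes it below -/
import Mathlib

section
/- Let q be a prime power, t ≥ 2, q ≥ t + 1. Let C be a normal rational curve of order t−1 in PG(t−1, q^t), i.e., C = φ(C₀) where C₀ = {⟨(1, y, …, y^{t−1})⟩ : y ∈ F_{q^t}} ∪ {⟨(0,…,0,1)⟩} and φ ∈ PGL(t, q^t). Then C is F_q-rational (i.e., C = ψ(C₀) for some ψ ∈ PGL(t, q^t) represented by a matrix with entries in F_q) if and only if C contains exactly q + 1 points all of whose coordinates can be chosen in F_q. -/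
open Matrix

/-- homogeneous moment vector -/
def nuv {K : Type*} [Field K] (t : ℕ) (x y : K) : Fin t → K := fun i => x ^ (t - 1 - i.val) * y ^ i.val

def brk {K : Type*} [Field K] (p r : K × K) : K := p.1 * r.2 - p.2 * r.1

lemma nuv_smul {K : Type*} [Field K] (t : ℕ) (c x y : K) :
    nuv t (c * x) (c * y) = c ^ (t - 1) • nuv t x y := by
  funext i
  have : t - 1 = (t - 1 - i.val) + i.val := by have := i.isLt; omega
  simp only [nuv, Pi.smul_apply, smul_eq_mul, mul_pow]
  conv_rhs => rw [show c ^ (t - 1) = c ^ (t - 1 - i.val) * c ^ i.val by rw [← pow_add, ← this]]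
  ring

lemma nuv_zero {K : Type*} [Field K] (t : ℕ) (ht : 2 ≤ t) : nuv t (0 : K) 0 = 0 := by
  have := nuv_smul t (0 : K) 0 0
  rw [zero_mul, zero_pow (by omega), zero_smul] at this
  exact this

lemma nuv_one {K : Type*} [Field K] (t : ℕ) (y : K) : nuv t 1 y = fun i : Fin t => y ^ i.val := by
  funext i; simp [nuv]

lemma nuv_inf {K : Type*} [Field K] (t : ℕ) :
    nuv t (0 : K) 1 = fun i : Fin t => if i.val = t - 1 then 1 else 0 := by
  funext i
  have := i.isLt
  simp only [nuv, one_pow, mul_one]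
  split_ifs with h
  · simp [h]
  · exact zero_pow (by omega)

lemma nuv_ne_zero {K : Type*} [Field K] (t : ℕ) (ht : 2 ≤ t) (p : K × K) (hp : p ≠ 0) :
    nuv t p.1 p.2 ≠ 0 := by
  intro h
  by_cases h1 : p.1 = 0
  · have h2 : p.2 ≠ 0 := fun h2 => hp (Prod.ext h1 h2)
    have := congrFun h ⟨t - 1, by omega⟩
    simp [nuv] at this
    exact h2 this.1
  · have := congrFun h ⟨0, by omega⟩
    simp [nuv] at this
    exact h1 this.1

lemma span_smul_eq' {K V : Type*} [Field K] [AddCommGroup V] [Module K V] (c : K) (hc : c ≠ 0) (v : V) :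
    Submodule.span K {c • v} = Submodule.span K {v} :=
  Submodule.span_singleton_smul_eq (IsUnit.mk0 c hc) v

lemma curve_eq {K : Type*} [Field K] (t : ℕ) :
    ({P | ∃ y : K, P = Submodule.span K {fun i : Fin t => y ^ i.val}} ∪
      {Submodule.span K {fun i : Fin t => if i.val = t - 1 then (1 : K) else 0}}) =
    {P | ∃ p : K × K, p ≠ 0 ∧ P = Submodule.span K {nuv t p.1 p.2}} := by
  ext P
  constructor
  · rintro (⟨y, rfl⟩ | h)
    · exact ⟨(1, y), by simp, by rw [nuv_one]⟩
    · exact ⟨(0, 1), by simp, by rw [nuv_inf]; exact h⟩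
  · rintro ⟨⟨x, y⟩, hp, rfl⟩
    by_cases hx : x = 0
    · subst hx
      have hy : y ≠ 0 := fun h => hp (by simp [h])
      right
      have := nuv_smul t y 0 1
      rw [mul_zero, mul_one] at this
      simp only [Set.mem_singleton_iff, this]
      rw [span_smul_eq' _ (pow_ne_zero _ hy), nuv_inf]
    · left
      refine ⟨y / x, ?_⟩
      have := nuv_smul t x 1 (y / x)
      rw [mul_one, mul_div_cancel₀ _ hx] at this
      simp only [this]
      rw [span_smul_eq' _ (pow_ne_zero _ hx), nuv_one]

lemma brk_ne {K : Type*} [Field K] (t : ℕ) (p r : K × K) (hp : p ≠ 0) (hr : r ≠ 0)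
    (h : Submodule.span K {nuv t p.1 p.2} ≠ Submodule.span K {nuv t r.1 r.2}) : brk p r ≠ 0 := by
  intro h0
  apply h
  obtain ⟨x, y⟩ := p
  obtain ⟨z, w⟩ := r
  simp only [brk] at h0 ⊢
  have : ∃ c : K, c ≠ 0 ∧ z = c * x ∧ w = c * y := by
    by_cases hx : x = 0
    · subst hx
      have hy : y ≠ 0 := fun h => hp (by simp [h])
      have hz : z = 0 := by
        have : y * z = 0 := by linear_combination -h0
        simpa [hy] using this
      subst hz
      have hw : w ≠ 0 := fun h => hr (by simp [h])
      exact ⟨w / y, div_ne_zero hw hy, by simp, by field_simp⟩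
    · have hw : w = z / x * y := by field_simp; linear_combination h0
      refine ⟨z / x, ?_, by field_simp, hw⟩
      intro hz
      apply hr
      have hz' : z = 0 := by simpa [hx] using hz
      rw [hz] at hw
      simp [hw, hz']
  obtain ⟨c, hc, rfl, rfl⟩ := this
  rw [nuv_smul, span_smul_eq' _ (pow_ne_zero _ hc)]

lemma prod_coeff {F K ι : Type*} [Field F] [Field K] (φ : F →+* K) [DecidableEq ι] (p : ι → F × F)
    (s : Finset ι) :
    ∃ c : ℕ → F, ∀ x y : K, ∏ j ∈ s, brk (x, y) (φ (p j).1, φ (p j).2) =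
      ∑ l ∈ Finset.range (s.card + 1), φ (c l) * (x ^ (s.card - l) * y ^ l) := by
  induction s using Finset.induction_on with
  | empty => exact ⟨fun _ => 1, fun x y => by simp⟩
  | insert a s ha ih =>
    obtain ⟨c, hc⟩ := ih
    refine ⟨fun l => (if l ≤ s.card then (p a).2 * c l else 0) -
      (if l = 0 then 0 else (p a).1 * c (l - 1)), fun x y => ?_⟩
    rw [Finset.prod_insert ha, hc, Finset.card_insert_of_notMem ha]
    simp only [map_sub, sub_mul, Finset.sum_sub_distrib]
    rw [Finset.sum_range_succ (n := s.card + 1), Finset.sum_range_succ' (n := s.card + 1)]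
    rw [brk, sub_mul, Finset.mul_sum, Finset.mul_sum]
    simp only [add_tsub_cancel_right, Nat.add_eq_zero_iff, one_ne_zero, and_false, if_false, if_true,
      map_zero, zero_mul, add_zero]
    rw [if_neg (by omega), map_zero, zero_mul, add_zero]
    refine congrArg₂ (· - ·) ?_ ?_
    · refine Finset.sum_congr rfl fun l hl => ?_
      have hl' : l ≤ s.card := by have := Finset.mem_range.1 hl; omega
      rw [if_pos hl', show s.card + 1 - l = (s.card - l) + 1 by omega, map_mul]
      ring
    · refine Finset.sum_congr rfl fun l hl => ?_
      rw [show s.card + 1 - (l + 1) = (s.card - l) by omega, map_mul]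
      ring

lemma exists_B {F K : Type*} [Field F] [Field K] (φ : F →+* K) (t : ℕ) (ht : 2 ≤ t)
    (p : Fin t → F × F) :
    ∃ B : Matrix (Fin t) (Fin t) F, ∀ (x y : K) k, (B.map φ *ᵥ nuv t x y) k =
      ∏ j ∈ Finset.univ.erase k, brk (x, y) (φ (p j).1, φ (p j).2) := by
  choose c hc using fun k : Fin t => prod_coeff φ p (Finset.univ.erase k)
  refine ⟨fun k l => c k l.val, fun x y k => ?_⟩
  rw [hc]
  simp only [Finset.card_erase_of_mem (Finset.mem_univ _), Finset.card_univ, Fintype.card_fin]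
  rw [show t - 1 + 1 = t by omega, Finset.sum_range]
  rfl

lemma B_mul {K : Type*} [Field K] (t : ℕ) (p : Fin t → K × K)
    (B : Matrix (Fin t) (Fin t) K) (hB : ∀ x y k, (B *ᵥ nuv t x y) k =
      ∏ j ∈ Finset.univ.erase k, brk (x, y) (p j)) :
    B * (Matrix.of fun i k => nuv t (p k).1 (p k).2 i) =
      Matrix.diagonal fun k => ∏ j ∈ Finset.univ.erase k, brk (p k) (p j) := by
  ext k m
  have : (B * (Matrix.of fun i k => nuv t (p k).1 (p k).2 i)) k m =
    (B *ᵥ nuv t (p m).1 (p m).2) k := rfl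
  rw [this, hB, Matrix.diagonal_apply]
  split_ifs with h
  · subst h; rfl
  · refine Finset.prod_eq_zero (i := m) (by simp [Ne.symm h]) ?_
    simp [brk]; ring

lemma map_span {K : Type*} [Field K] {t : ℕ} (M : Matrix (Fin t) (Fin t) K) (v : Fin t → K) :
    Submodule.map (Matrix.toLin' M) (Submodule.span K {v}) = Submodule.span K {M *ᵥ v} := by
  rw [Submodule.map_span]; simp

lemma map_inj {K : Type*} [Field K] {t : ℕ} (M : Matrix (Fin t) (Fin t) K) (hM : IsUnit M.det) :
    Function.Injective (fun P : Submodule K (Fin t → K) => Submodule.map (Matrix.toLin' M) P) := by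
  apply Submodule.map_injective_of_injective
  exact Matrix.mulVec_injective_of_isUnit ((Matrix.isUnit_iff_isUnit_det M).2 hM)

/-- Core: matrix over F with proportional values. -/
lemma core {F E : Type*} [Field F] [Field E] [Algebra F E] (t : ℕ) (ht : 2 ≤ t)
    (M : Matrix (Fin t) (Fin t) E) (hM : IsUnit M.det)
    (p : Fin t → E × E) (p0 p1 : E × E) (w : Fin t → Fin t → F) (w0 w1 : Fin t → F)
    (m : Fin t → E) (m0 m1 : E) (hm : ∀ k, m k ≠ 0) (hm0 : m0 ≠ 0) (hm1 : m1 ≠ 0)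
    (h : ∀ k, M *ᵥ nuv t (p k).1 (p k).2 = m k • fun i => algebraMap F E (w k i))
    (h0 : M *ᵥ nuv t p0.1 p0.2 = m0 • fun i => algebraMap F E (w0 i))
    (h1 : M *ᵥ nuv t p1.1 p1.2 = m1 • fun i => algebraMap F E (w1 i))
    (hp : ∀ k j, k ≠ j → brk (p k) (p j) ≠ 0)
    (hp0 : ∀ k, brk p0 (p k) ≠ 0) (hp1 : ∀ k, brk p1 (p k) ≠ 0) (hp01 : brk p1 p0 ≠ 0) :
    ∃ Mq : Matrix (Fin t) (Fin t) F, IsUnit Mq.det ∧ ∀ r : E × E, ∃ (r' : E × E) (a : E),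
      M *ᵥ nuv t r.1 r.2 = a • (Mq.map (algebraMap F E) *ᵥ nuv t r'.1 r'.2) := by
  obtain ⟨B, hB⟩ : ∃ B : Matrix (Fin t) (Fin t) E, ∀ x y k, (B *ᵥ nuv t x y) k =
      ∏ j ∈ Finset.univ.erase k, brk (x, y) (p j) := exists_B (RingHom.id E) t ht p
  set φ := algebraMap F E
  set V : Matrix (Fin t) (Fin t) E := Matrix.of fun i k => nuv t (p k).1 (p k).2 i with hV
  set D : Fin t → E := fun k => ∏ j ∈ Finset.univ.erase k, brk (p k) (p j) with hD
  have hBV : B * V = Matrix.diagonal D := B_mul t p B hB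
  have hDne : ∀ k, D k ≠ 0 := fun k => Finset.prod_ne_zero_iff.2 fun j hj =>
    hp k j (Finset.ne_of_mem_erase hj).symm
  have hdet : B.det * V.det ≠ 0 := by
    rw [← Matrix.det_mul, hBV, Matrix.det_diagonal]
    exact Finset.prod_ne_zero_iff.2 fun k _ => hDne k
  have hBd : B.det ≠ 0 := left_ne_zero_of_mul hdet
  have hVd : V.det ≠ 0 := right_ne_zero_of_mul hdet
  set W : Matrix (Fin t) (Fin t) F := Matrix.of fun i k => w k i with hW
  have hMV : M * V = W.map φ * Matrix.diagonal m := by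
    ext i k
    have e1 : (M * V) i k = (M *ᵥ nuv t (p k).1 (p k).2) i := rfl
    rw [e1, h, Matrix.mul_diagonal]
    simp [hW, mul_comm]
  have hWd : (W.map φ).det ≠ 0 := by
    have : (M * V).det ≠ 0 := by rw [Matrix.det_mul]; exact mul_ne_zero hM.ne_zero hVd
    rw [hMV, Matrix.det_mul] at this
    exact left_ne_zero_of_mul this
  have hWd' : W.det ≠ 0 := by
    intro h0
    apply hWd
    have := RingHom.map_det φ W
    rw [h0, map_zero] at this
    exact this.symm
  set c : Fin t → E := fun k => m k / D k with hc
  have hcne : ∀ k, c k ≠ 0 := fun k => div_ne_zero (hm k) (hDne k)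
  have hMf : M = W.map φ * Matrix.diagonal c * B := by
    have hu : IsUnit V := (Matrix.isUnit_iff_isUnit_det V).2 (IsUnit.mk0 _ hVd)
    apply hu.mul_right_cancel
    rw [hMV, Matrix.mul_assoc, hBV, Matrix.mul_assoc, Matrix.diagonal_mul_diagonal]
    congr 2
    funext k
    simp [hc, hDne k]
  have hWinj := Matrix.mulVec_injective_of_isUnit
    ((Matrix.isUnit_iff_isUnit_det (W.map φ)).2 (IsUnit.mk0 _ hWd))
  have hMr : ∀ r : E × E, M *ᵥ nuv t r.1 r.2 = W.map φ *ᵥ fun k =>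
      c k * ∏ j ∈ Finset.univ.erase k, brk r (p j) := by
    intro r
    rw [hMf, Matrix.mul_assoc, ← Matrix.mulVec_mulVec]
    congr 1
    funext k
    rw [← Matrix.mulVec_mulVec, Matrix.mulVec_diagonal, hB]
  have key : ∀ (r : E × E) (w' : Fin t → F) (m' : E), m' ≠ 0 → (∀ k, brk r (p k) ≠ 0) →
      (M *ᵥ nuv t r.1 r.2 = m' • fun i => φ (w' i)) →
      ∃ γ : Fin t → F, (∀ k, γ k ≠ 0) ∧
        ∀ k, c k * ∏ j, brk r (p j) = m' * φ (γ k) * brk r (p k) := by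
    intro r w' m' hm' hr hw'
    have e2 : (fun i => φ (w' i)) = W.map φ *ᵥ fun k => φ ((W⁻¹ *ᵥ w') k) := by
      have e3 : W *ᵥ (W⁻¹ *ᵥ w') = w' := by
        rw [Matrix.mulVec_mulVec, Matrix.mul_nonsing_inv _ (IsUnit.mk0 _ hWd'), Matrix.one_mulVec]
      funext i
      conv_lhs => rw [← e3]
      exact RingHom.map_mulVec φ W _ i
    rw [hMr, e2, ← Matrix.mulVec_smul] at hw'
    have e4 := hWinj hw'
    have e5 : ∀ k, c k * ∏ j ∈ Finset.univ.erase k, brk r (p j) = m' * φ ((W⁻¹ *ᵥ w') k) :=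
      fun k => congrFun e4 k
    refine ⟨W⁻¹ *ᵥ w', fun k hk => ?_, fun k => ?_⟩
    · have := e5 k
      rw [hk, map_zero, mul_zero] at this
      exact mul_ne_zero (hcne k) (Finset.prod_ne_zero_iff.2 fun j _ => hr j) this
    · rw [← e5, ← Finset.prod_erase_mul _ _ (Finset.mem_univ k), mul_assoc]
  obtain ⟨γ, hγ, hγ'⟩ := key p0 w0 m0 hm0 hp0 h0
  obtain ⟨δ, hδ, hδ'⟩ := key p1 w1 m1 hm1 hp1 h1
  set A0 := ∏ j, brk p0 (p j) with hA0
  set A1 := ∏ j, brk p1 (p j) with hA1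
  have hA0n : A0 ≠ 0 := Finset.prod_ne_zero_iff.2 fun j _ => hp0 j
  have hA1n : A1 ≠ 0 := Finset.prod_ne_zero_iff.2 fun j _ => hp1 j
  set ρ : Fin t → F := fun k => δ k / γ k with hρ
  set κ : E := A0 * m1 / (m0 * A1) with hκ
  have hκn : κ ≠ 0 := by simp [hκ, hA0n, hA1n, hm0, hm1]
  have hab : ∀ k, brk p0 (p k) = κ * φ (ρ k) * brk p1 (p k) := by
    intro k
    have hg : φ (γ k) ≠ 0 := by simpa using hγ k
    have e1 := hγ' k
    have e2 := hδ' k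
    have : m0 * A1 * φ (γ k) * brk p0 (p k) = A0 * m1 * φ (δ k) * brk p1 (p k) := by
      linear_combination A0 * e2 - A1 * e1
    simp only [hκ, hρ, map_div₀]
    field_simp
    linear_combination this
  obtain ⟨BF, hBF⟩ := exists_B φ t ht (fun k => ((1 : F), ρ k))
  have hρinj : ∀ k j, k ≠ j → ρ k ≠ ρ j := by
    intro k j hkj he
    have e1 := hab k
    have e2 := hab j
    rw [he] at e1
    have : brk p1 p0 * brk (p k) (p j) = 0 := by
      have pl : brk p1 p0 * brk (p k) (p j) =
        brk p1 (p k) * brk p0 (p j) - brk p0 (p k) * brk p1 (p j) := by simp only [brk]; ring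
      rw [pl, e1, e2]; ring
    exact mul_ne_zero hp01 (hp k j hkj) this
  have hBFd : BF.det ≠ 0 := by
    intro h0
    have := congrArg Matrix.det (B_mul t _ (BF.map φ) hBF)
    have h2 := RingHom.map_det φ BF
    rw [h0, map_zero] at h2
    rw [Matrix.det_mul, Matrix.det_diagonal, show (BF.map φ).det = 0 from h2.symm, zero_mul] at this
    revert this
    refine (Finset.prod_ne_zero_iff.2 fun k _ => Finset.prod_ne_zero_iff.2 fun j hj => ?_).symm
    have := hρinj k j (Finset.ne_of_mem_erase hj).symm
    simp only [brk, map_one, one_mul, mul_one]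
    exact sub_ne_zero.2 fun h => this (φ.injective h).symm
  refine ⟨W * Matrix.diagonal δ * BF, ?_, fun r => ?_⟩
  · rw [Matrix.det_mul, Matrix.det_mul, Matrix.det_diagonal]
    exact IsUnit.mk0 _ (mul_ne_zero (mul_ne_zero hWd' (Finset.prod_ne_zero_iff.2 fun k _ => hδ k)) hBFd)
  · set X := κ * brk p1 r
    set Y := brk p0 r
    have hBFE : ∀ k, (BF.map φ *ᵥ nuv t X Y) k = ∏ j ∈ Finset.univ.erase k, (X * φ (ρ j) - Y) := by
      intro k
      rw [hBF]
      simp [brk]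
    refine ⟨(X, Y), (brk p1 p0)⁻¹ ^ (t - 1) * m1, ?_⟩
    rw [hMr]
    rw [Matrix.map_mul, Matrix.map_mul, Matrix.mul_assoc, ← Matrix.mulVec_mulVec, ← Matrix.mulVec_smul]
    congr 1
    funext k
    rw [Pi.smul_apply, ← Matrix.mulVec_mulVec, Matrix.diagonal_map (map_zero φ), Matrix.mulVec_diagonal, hBFE]
    have hbr : ∀ j, brk r (p j) = (brk p1 p0)⁻¹ * (brk p1 (p j) * (X * φ (ρ j) - Y)) := by
      intro j
      have e := hab j
      rw [eq_inv_mul_iff_mul_eq₀ hp01]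
      have : brk p1 p0 * brk r (p j) = brk p1 r * brk p0 (p j) - brk p0 r * brk p1 (p j) := by
        simp only [brk]; ring
      rw [this, e]; ring
    rw [Finset.prod_congr rfl fun j _ => hbr j, Finset.prod_mul_distrib, Finset.prod_mul_distrib,
      Finset.prod_const, Finset.card_erase_of_mem (Finset.mem_univ _), Finset.card_univ, Fintype.card_fin]
    have e1 : c k * ∏ j ∈ Finset.univ.erase k, brk p1 (p j) = m1 * φ (δ k) := by
      have := hδ' k
      rw [hA1, ← Finset.prod_erase_mul _ _ (Finset.mem_univ k), ← mul_assoc] at this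
      exact mul_right_cancel₀ (hp1 k) this
    simp only [smul_eq_mul]
    linear_combination (brk p1 p0)⁻¹ ^ (t - 1) * (∏ j ∈ Finset.univ.erase k, (X * φ (ρ j) - Y)) * e1

theorem stmt15 (q t : ℕ) (hq : IsPrimePow q) (ht : 2 ≤ t) (hqt : t + 1 ≤ q)
    (F E : Type*) [Field F] [Field E] [Algebra F E] [Fintype F] [Fintype E]
    (hF : Fintype.card F = q) (hE : Fintype.card E = q ^ t)
    (C₀ : Set (Submodule E (Fin t → E)))
    (hC₀ : C₀ = {P | ∃ y : E, P = Submodule.span E {fun i : Fin t => y ^ i.val}} ∪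
      {Submodule.span E {fun i : Fin t => if i.val = t - 1 then 1 else 0}})
    (C : Set (Submodule E (Fin t → E)))
    (M : Matrix (Fin t) (Fin t) E) (hM : IsUnit M.det)
    (hC : C = (fun P => Submodule.map (Matrix.toLin' M) P) '' C₀) :
    (∃ Mq : Matrix (Fin t) (Fin t) F, IsUnit Mq.det ∧
        C = (fun P => Submodule.map (Matrix.toLin' (Mq.map (algebraMap F E))) P) '' C₀) ↔
      Set.ncard {P ∈ C | ∃ w : Fin t → F, w ≠ 0 ∧
        P = Submodule.span E {fun i => algebraMap F E (w i)}} = q + 1 := by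
  have hinjvec : ∀ N : Matrix (Fin t) (Fin t) E, IsUnit N.det → Function.Injective (N *ᵥ ·) :=
    fun N hN => Matrix.mulVec_injective_of_isUnit ((Matrix.isUnit_iff_isUnit_det N).2 hN)
  have hdetmap : ∀ N : Matrix (Fin t) (Fin t) F, IsUnit N.det →
      IsUnit (N.map (algebraMap F E)).det := by
    intro N hN
    have := RingHom.map_det (algebraMap F E) N
    exact (this ▸ hN.map (algebraMap F E) : IsUnit ((algebraMap F E).mapMatrix N).det)
  have hne : ∀ (N : Matrix (Fin t) (Fin t) E) (_ : IsUnit N.det) (p : E × E), p ≠ 0 →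
      N *ᵥ nuv t p.1 p.2 ≠ 0 := fun N hN p hp h0 =>
    nuv_ne_zero t ht p hp (hinjvec N hN (by simpa using h0))
  rw [curve_eq t] at hC₀
  constructor
  · rintro ⟨Mq, hMq, hCq⟩
    have hMqE := hdetmap Mq hMq
    set φ := algebraMap F E
    let f : Option F → Submodule E (Fin t → E) := fun o =>
      Submodule.map (Matrix.toLin' (Mq.map φ))
        (o.elim (Submodule.span E {nuv t 0 1}) (fun a => Submodule.span E {nuv t 1 (φ a)}))
    have hinf : ∀ a : E, Submodule.span E {nuv t 0 1} ≠ Submodule.span E {nuv t 1 a} := by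
      intro a h
      have : nuv t (1 : E) a ∈ Submodule.span E {nuv t (0 : E) 1} := by
        rw [h]; exact Submodule.mem_span_singleton_self _
      obtain ⟨c, hc⟩ := Submodule.mem_span_singleton.1 this
      have := congrFun hc ⟨0, by omega⟩
      simp [nuv, show t - 1 ≠ 0 by omega] at this
    have hf : Function.Injective f := by
      intro a b hab
      have h := map_inj _ hMqE hab
      rcases a with _ | a <;> rcases b with _ | b
      · rfl
      · exact (hinf _ h).elim
      · exact (hinf _ h.symm).elim
      · have : nuv t (1 : E) (φ b) ∈ Submodule.span E {nuv t (1 : E) (φ a)} := by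
          have h' : Submodule.span E {nuv t (1 : E) (φ a)} = Submodule.span E {nuv t (1 : E) (φ b)} := h
          rw [h']; exact Submodule.mem_span_singleton_self _
        obtain ⟨c, hc⟩ := Submodule.mem_span_singleton.1 this
        have h0 := congrFun hc ⟨0, by omega⟩
        have h1 := congrFun hc ⟨1, by omega⟩
        simp [nuv] at h0 h1
        rw [h0, one_mul] at h1
        rw [φ.injective h1]
    have hrat : ∀ v : Fin t → F, v ≠ 0 → ∃ w : Fin t → F, w ≠ 0 ∧
        Submodule.span E {Mq.map φ *ᵥ fun i => φ (v i)} = Submodule.span E {fun i => φ (w i)} := by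
      intro v hv
      refine ⟨Mq *ᵥ v, fun h0 => hv ?_, ?_⟩
      · exact Matrix.mulVec_injective_of_isUnit ((Matrix.isUnit_iff_isUnit_det Mq).2 hMq)
          (by simpa using h0)
      · congr 2
        funext i
        exact (RingHom.map_mulVec φ Mq v i).symm
    have hset : {P ∈ C | ∃ w : Fin t → F, w ≠ 0 ∧ P = Submodule.span E {fun i => φ (w i)}} =
        Set.range f := by
      ext P
      constructor
      · rintro ⟨hP, w, hw, hPw⟩
        rw [hCq, hC₀] at hP
        obtain ⟨_, ⟨p, hp, rfl⟩, rfl⟩ := hP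
        have hpc : Submodule.span E {nuv t p.1 p.2} ∈
          {P | ∃ p : E × E, p ≠ 0 ∧ P = Submodule.span E {nuv t p.1 p.2}} := ⟨p, hp, rfl⟩
        rw [← curve_eq t] at hpc
        rcases hpc with ⟨y, hy⟩ | hy
        · simp only [hy, ← nuv_one] at hPw ⊢
          rw [map_span] at hPw
          have : Mq.map φ *ᵥ nuv t 1 y ∈ Submodule.span E {fun i => φ (w i)} := by
            rw [← hPw]; exact Submodule.mem_span_singleton_self _
          obtain ⟨c, hc⟩ := Submodule.mem_span_singleton.1 this
          have e3 : Mq *ᵥ (Mq⁻¹ *ᵥ w) = w := by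
            rw [Matrix.mulVec_mulVec, Matrix.mul_nonsing_inv _ hMq, Matrix.one_mulVec]
          have e4 : (fun i => φ (w i)) = Mq.map φ *ᵥ fun k => φ ((Mq⁻¹ *ᵥ w) k) := by
            funext i
            conv_lhs => rw [← e3]
            exact RingHom.map_mulVec φ Mq _ i
          rw [e4, ← Matrix.mulVec_smul] at hc
          have e5 := hinjvec _ hMqE hc
          have h0 := congrFun e5 ⟨0, by omega⟩
          have h1 := congrFun e5 ⟨1, by omega⟩
          simp only [Pi.smul_apply, smul_eq_mul, nuv, one_pow, pow_zero, pow_one, mul_one, one_mul] at h0 h1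
          set u := Mq⁻¹ *ᵥ w
          refine ⟨some (u ⟨1, by omega⟩ / u ⟨0, by omega⟩), ?_⟩
          have hy' : φ (u ⟨1, by omega⟩ / u ⟨0, by omega⟩) = y := by
            rw [map_div₀, ← h1]
            have hn : φ (u ⟨0, by omega⟩) ≠ 0 := right_ne_zero_of_mul (h0.trans_ne one_ne_zero)
            rw [div_eq_iff hn]
            linear_combination (-φ (u ⟨1, by omega⟩)) * h0
          simp only [f, Option.elim, hy']
        · refine ⟨none, ?_⟩
          simp only [f, Option.elim, nuv_inf]
          rw [← Set.mem_singleton_iff.1 hy]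
      · rintro ⟨o, rfl⟩
        rcases o with _ | a
        · refine ⟨?_, ?_⟩
          · rw [hCq, hC₀]
            exact ⟨_, ⟨(0, 1), by simp, rfl⟩, rfl⟩
          · simp only [f, Option.elim, map_span]
            have e : nuv t (0 : E) 1 = fun i => φ (nuv t (0 : F) 1 i) := by
              funext i; simp [nuv]
            rw [e]
            exact hrat _ (nuv_ne_zero t ht (0, 1) (by simp))
        · refine ⟨?_, ?_⟩
          · rw [hCq, hC₀]
            exact ⟨_, ⟨(1, φ a), by simp, rfl⟩, rfl⟩
          · simp only [f, Option.elim, map_span]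
            have e : nuv t (1 : E) (φ a) = fun i => φ (nuv t (1 : F) a i) := by
              funext i; simp [nuv]
            rw [e]
            exact hrat _ (nuv_ne_zero t ht (1, a) (by simp))
    rw [hset, ← Set.image_univ, Set.ncard_image_of_injective _ hf, Set.ncard_univ,
      Nat.card_eq_fintype_card, Fintype.card_option, hF]
  · intro hcard
    set S := {P ∈ C | ∃ w : Fin t → F, w ≠ 0 ∧
        P = Submodule.span E {fun i => algebraMap F E (w i)}} with hS
    have hSf : S.Finite := Set.toFinite S
    haveI := hSf.fintype
    have hle : Fintype.card (Option (Option (Fin t))) ≤ Fintype.card S := by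
      rw [← Nat.card_eq_fintype_card (α := S), Nat.card_coe_set_eq, hcard]
      simp; omega
    obtain ⟨g⟩ := Function.Embedding.nonempty_of_card_le hle
    have hdata : ∀ o, ∃ (p : E × E) (w : Fin t → F) (m : E), p ≠ 0 ∧ m ≠ 0 ∧
        (M *ᵥ nuv t p.1 p.2 = m • fun i => algebraMap F E (w i)) ∧
        (g o : Submodule E (Fin t → E)) =
          Submodule.map (Matrix.toLin' M) (Submodule.span E {nuv t p.1 p.2}) := by
      intro o
      obtain ⟨hP, w, hw, hPw⟩ := (g o).2
      rw [hC, hC₀] at hP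
      obtain ⟨_, ⟨p, hp, rfl⟩, hpp⟩ := hP
      have hpp' := hpp
      simp only [] at hpp'
      rw [map_span, hPw] at hpp'
      have : M *ᵥ nuv t p.1 p.2 ∈ Submodule.span E {fun i => algebraMap F E (w i)} := by
        rw [← hpp']; exact Submodule.mem_span_singleton_self _
      obtain ⟨c, hc⟩ := Submodule.mem_span_singleton.1 this
      refine ⟨p, w, c, hp, ?_, hc.symm, hpp.symm⟩
      rintro rfl
      rw [zero_smul] at hc
      exact hne M hM p hp hc.symm
    choose p w m hp hm hpm hgp using hdata
    have hbr : ∀ a b, a ≠ b → brk (p a) (p b) ≠ 0 := by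
      intro a b hab
      refine brk_ne t _ _ (hp a) (hp b) fun h => hab (g.injective (Subtype.ext ?_))
      rw [hgp, hgp, h]
    obtain ⟨Mq, hMq, hMM⟩ := core (F := F) t ht M hM (fun k => p (some (some k))) (p (some none)) (p none)
      (fun k => w (some (some k))) (w (some none)) (w none)
      (fun k => m (some (some k))) (m (some none)) (m none)
      (fun k => hm _) (hm _) (hm _) (fun k => hpm _) (hpm _) (hpm _)
      (fun k j hkj => hbr _ _ (by simpa using hkj)) (fun k => hbr _ _ (by simp))
      (fun k => hbr _ _ (by simp)) (hbr _ _ (by simp))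
    refine ⟨Mq, hMq, ?_⟩
    apply Set.eq_of_subset_of_ncard_le
    · rw [hC, hC₀]
      rintro _ ⟨_, ⟨r, hr, rfl⟩, rfl⟩
      obtain ⟨r', a, hra⟩ := hMM r
      have hn := hne M hM r hr
      have ha : a ≠ 0 := by
        rintro rfl
        exact hn (by rw [hra, zero_smul])
      have hr' : r' ≠ 0 := by
        rintro rfl
        apply hn
        rw [hra]
        simp [nuv_zero t ht]
      refine ⟨_, ⟨r', hr', rfl⟩, ?_⟩
      simp only [map_span]
      rw [hra, span_smul_eq' _ ha]
    · rw [hC, Set.ncard_image_of_injective _ (map_inj _ hM),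
        Set.ncard_image_of_injective _ (map_inj _ (hdetmap Mq hMq))]
    · exact Set.toFinite _
end

section
/- Let F be a finite field of order q′ = pⁿ, and let d > 1 be a divisor of q′ − 1, say q′ − 1 = d·m. Define Ψ(x) = x^m for x ∈ F. Suppose f : F → F is a bijection with f(0) = 0, f(1) = 1, and Ψ(f(x) − f(y)) = Ψ(x − y) for all x, y ∈ F. Then there exists an integer j with 0 ≤ j < n and d | p^j − 1 such that f(x) = x^{p^j} for all x ∈ F. -/
namespace CMc
open Polynomial
set_option linter.unusedSectionVars false

/-- Lucas with respect to a power of `p`, in non-vanishing form. -/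
lemma lucas_split {p : ℕ} (hp : p.Prime) (M c u v : ℕ) (hu : u < p ^ c) :
    ¬ p ∣ M.choose (u + p ^ c * v) ↔ ¬ p ∣ M.choose u ∧ ¬ p ∣ (M / p ^ c).choose v := by
  have := Fact.mk hp
  have hpc : 0 < p ^ c := pow_pos hp.pos c
  have e1 := @Choose.choose_modEq_choose_mul_prod_range_choose M (u + p ^ c * v) p _ c
  have e2 := @Choose.choose_modEq_choose_mul_prod_range_choose M u p _ c
  have d1 : (u + p ^ c * v) / p ^ c = v := by
    rw [Nat.add_mul_div_left _ _ hpc, Nat.div_eq_of_lt hu, zero_add]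
  have d2 : u / p ^ c = 0 := Nat.div_eq_of_lt hu
  have d3 : ∀ i ∈ Finset.range c, (u + p ^ c * v) / p ^ i % p = u / p ^ i % p := by
    intro i hi
    have hi' : i < c := Finset.mem_range.1 hi
    obtain ⟨t, rfl⟩ := Nat.exists_eq_add_of_lt hi'
    have : u + p ^ (i + t + 1) * v = u + p ^ i * (p * (p ^ t * v)) := by ring
    rw [this, Nat.add_mul_div_left _ _ (pow_pos hp.pos i), Nat.add_mul_mod_self_left]
  rw [d1] at e1
  rw [Finset.prod_congr rfl (fun i hi => by rw [d3 i hi])] at e1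
  rw [d2, Nat.choose_zero_right] at e2
  rw [← Int.natCast_dvd_natCast, ← Int.natCast_dvd_natCast, ← Int.natCast_dvd_natCast,
    e1.dvd_iff, e2.dvd_iff,
    (Nat.prime_iff_prime_int.1 hp).dvd_mul]
  simp
  tauto

lemma lucas_sum {p : ℕ} (hp : p.Prime) (M c u v : ℕ) (hu : u < p ^ c)
    (h1 : ¬ p ∣ M.choose u) (h2 : ¬ p ∣ M.choose (p ^ c * v)) :
    ¬ p ∣ M.choose (u + p ^ c * v) := by
  rw [lucas_split hp M c u v hu]
  have := (lucas_split hp M c 0 v (pow_pos hp.pos c)).1 (by simpa using h2)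
  exact ⟨h1, this.2⟩

lemma lucas_top {p : ℕ} (hp : p.Prime) (M c : ℕ) :
    ¬ p ∣ M.choose (p ^ c * (M / p ^ c)) := by
  have := (lucas_split hp M c 0 (M / p ^ c) (pow_pos hp.pos c)).2
    (by simpa using hp.one_lt.ne')
  simpa using this

lemma lucas_log {p : ℕ} (hp : p.Prime) (j : ℕ) (hj : j ≠ 0) :
    ¬ p ∣ j.choose (p ^ (Nat.log p j)) := by
  have := (lucas_split hp j (Nat.log p j) 0 1 (pow_pos hp.pos _)).2 ?_
  · simpa using this
  · refine ⟨by simpa using hp.one_lt.ne', ?_⟩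
    rw [Nat.choose_one_right]
    intro h
    have h1 : 0 < j / p ^ Nat.log p j :=
      Nat.div_pos (Nat.pow_log_le_self p hj) (pow_pos hp.pos _)
    have h2 : j / p ^ Nat.log p j < p := by
      rw [Nat.div_lt_iff_lt_mul (pow_pos hp.pos _), ← pow_succ']
      exact Nat.lt_pow_succ_log_self hp.one_lt j
    exact absurd (Nat.le_of_dvd h1 h) (by omega)

lemma extract {F M : Type*} [Field F] [AddCommGroup M] [Module F M] (U : Submodule F M)
    (s : Finset F) (N : ℕ) (hN : N < s.card) (φ : ℕ → M)
    (h : ∀ y ∈ s, ∑ i ∈ Finset.range (N + 1), y ^ i • φ i ∈ U) (i : ℕ) (hi : i ≤ N) :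
    φ i ∈ U := by
  by_contra hc
  obtain ⟨l, hl, hU⟩ := Submodule.exists_le_ker_of_notMem hc
  let P : F[X] := ∑ i ∈ Finset.range (N + 1), C (l (φ i)) * X ^ i
  have hdeg : P.degree < s.card := by
    refine lt_of_le_of_lt (b := (N : WithBot ℕ)) ?_ (by exact_mod_cast hN)
    refine (degree_sum_le _ _).trans (Finset.sup_le fun j hj => ?_)
    refine (degree_C_mul_X_pow_le _ _).trans ?_
    exact_mod_cast Nat.lt_succ_iff.1 (Finset.mem_range.1 hj)
  have h0 : P = 0 := by
    refine eq_zero_of_degree_lt_of_eval_finset_eq_zero s hdeg fun y hy => ?_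
    have := LinearMap.mem_ker.1 (hU (h y hy))
    rw [map_sum] at this
    simp only [P, eval_finsetSum, eval_mul, eval_C, eval_pow, eval_X]
    rw [← this]
    refine Finset.sum_congr rfl fun j _ => ?_
    rw [map_smul, smul_eq_mul, mul_comm]
  have : P.coeff i = l (φ i) := by
    simp only [P, finsetSum_coeff, coeff_C_mul_X_pow]
    rw [Finset.sum_ite_eq]
    simp [Nat.lt_succ_iff.2 hi]
  rw [h0] at this
  exact hl (by simpa using this.symm)

variable {F : Type*} [Field F] [Fintype F]

/-- interpolation polynomial of a function -/
noncomputable def tp : (F → F) →ₗ[F] F[X] := by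
  classical exact Lagrange.interpolate Finset.univ id

lemma tp_eval (φ : F → F) (x : F) : (tp φ).eval x = φ x := by
  classical
  exact Lagrange.eval_interpolate_at_node (v := id) φ (fun _ _ _ _ h => h) (Finset.mem_univ x)

lemma tp_eq (φ : F → F) (P : F[X]) (hP : P.natDegree < Fintype.card F) (h : ∀ x, P.eval x = φ x) :
    tp φ = P := by
  classical
  refine (Lagrange.eq_interpolate_of_eval_eq (s := Finset.univ) (v := id) φ
    (fun _ _ _ _ h => h) ?_ (fun i _ => h i)).symm
  exact lt_of_le_of_lt degree_le_natDegree (by exact_mod_cast hP)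

lemma tp_lt (φ : F → F) : (tp φ).natDegree < Fintype.card F := by
  classical
  have : (tp φ).degree < Fintype.card F :=
    Lagrange.degree_interpolate_lt (s := Finset.univ) (v := id) φ (fun _ _ _ _ h => h)
  by_cases h : tp φ = 0
  · rw [h, natDegree_zero]
    exact Fintype.card_pos
  · exact (natDegree_lt_iff_degree_lt h).2 this

lemma tp_pow (j : ℕ) (hj : j < Fintype.card F) : tp (fun x : F => x ^ j) = X ^ j :=
  tp_eq _ _ (by simpa using hj) (by simp)

lemma tp_const (c : F) : tp (fun _ : F => c) = C c :=
  tp_eq _ _ (by simpa using Fintype.card_pos) (by simp)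

lemma tp_mul (φ ψ : F → F) (h : (tp φ).natDegree + (tp ψ).natDegree < Fintype.card F) :
    tp (fun x => φ x * ψ x) = tp φ * tp ψ :=
  tp_eq _ _ (lt_of_le_of_lt natDegree_mul_le h) (by simp [tp_eval])

lemma tp_powf (φ : F → F) (k : ℕ) (h : k * (tp φ).natDegree < Fintype.card F) :
    tp (fun x => φ x ^ k) = tp φ ^ k :=
  tp_eq _ _ (lt_of_le_of_lt natDegree_pow_le h) (by simp [tp_eval])

def IsG (m : ℕ) (g : F → F) : Prop := ∀ x y, (g x - g y) ^ m = (x - y) ^ m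

lemma IsG.comp {m : ℕ} {g h : F → F} (hg : IsG m g) (hh : IsG m h) : IsG m (g ∘ h) :=
  fun x y => (hg _ _).trans (hh x y)

lemma IsG.id {m : ℕ} : IsG m (fun x : F => x) := fun _ _ => rfl

lemma IsG.add {m : ℕ} (y : F) : IsG m (fun x : F => x + y) := fun _ _ => by simp

lemma IsG.smul {m : ℕ} (h : F) (hh : h ^ m = 1) : IsG m (fun x : F => h * x) := fun _ _ => by
  rw [← mul_sub, mul_pow, hh, one_mul]

lemma IsG.surj {m : ℕ} (hm : 0 < m) {g : F → F} (hg : IsG m g) : Function.Surjective g := by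
  refine Finite.injective_iff_surjective.1 fun x y h => ?_
  have := hg x y
  rw [h, sub_self, zero_pow hm.ne'] at this
  exact sub_eq_zero.1 (pow_eq_zero_iff hm.ne' |>.1 this.symm)

def V (F : Type*) [Field F] (m : ℕ) : Submodule F (F → F) :=
  Submodule.span F (Set.range fun y : F => fun x : F => (x - y) ^ m)

def W (F : Type*) [Field F] (m : ℕ) : Submodule F (F → F) :=
  Submodule.span F ({g | IsG m g} ∪ {fun _ => 1})

lemma V_comp {m : ℕ} (hm : 0 < m) {g φ : F → F} (hg : IsG m g) (hφ : φ ∈ V F m) :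
    (fun x => φ (g x)) ∈ V F m := by
  induction hφ using Submodule.span_induction with
  | mem φ h =>
    obtain ⟨y, rfl⟩ := h
    obtain ⟨z, rfl⟩ := hg.surj hm y
    refine Submodule.subset_span ⟨z, ?_⟩
    funext x
    exact (hg x z).symm
  | zero => exact (V F m).zero_mem
  | add a b _ _ ha hb => exact (V F m).add_mem ha hb
  | smul c a _ ha => exact (V F m).smul_mem c ha

lemma W_comp {m : ℕ} {g φ : F → F} (hg : IsG m g) (hφ : φ ∈ W F m) :
    (fun x => φ (g x)) ∈ W F m := by
  induction hφ using Submodule.span_induction with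
  | mem φ h =>
    rcases h with h | h
    · exact Submodule.subset_span (Or.inl (IsG.comp h hg))
    · rw [Set.mem_singleton_iff] at h
      subst h
      exact Submodule.subset_span (Or.inr rfl)
  | zero => exact (W F m).zero_mem
  | add a b _ _ ha hb => exact (W F m).add_mem ha hb
  | smul c a _ ha => exact (W F m).smul_mem c ha

lemma one_mem_W {m : ℕ} : (fun _ => 1) ∈ W F m := Submodule.subset_span (Or.inr rfl)

lemma G_mem_W {m : ℕ} {g : F → F} (hg : IsG m g) : g ∈ W F m :=
  Submodule.subset_span (Or.inl hg)

lemma shift_extract (U : Submodule F (F → F)) (j : ℕ) (hj : j < Fintype.card F) (s : F)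
    (hs : s ≠ 0) (h : ∀ y : F, (fun x : F => (x + s * y) ^ j) ∈ U) (p : ℕ) [CharP F p] (i : ℕ)
    (hi : ¬ p ∣ j.choose i) : (fun x : F => x ^ i) ∈ U := by
  have hij : i ≤ j := by
    by_contra hc
    rw [Nat.choose_eq_zero_of_lt (by omega)] at hi
    simp at hi
  have key := extract U Finset.univ j (by simpa using hj)
    (fun t => fun x : F => x ^ (j - t) * s ^ t * (j.choose t : F)) ?_ (j - i) (Nat.sub_le _ _)
  · rw [Nat.choose_symm hij, Nat.sub_sub_self hij] at key
    have hc : s ^ (j - i) * (j.choose i : F) ≠ 0 := by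
      refine mul_ne_zero (pow_ne_zero _ hs) ?_
      rwa [Ne, CharP.cast_eq_zero_iff F p]
    have := U.smul_mem (s ^ (j - i) * (j.choose i : F))⁻¹ key
    convert this using 1
    funext x
    simp only [Pi.smul_apply, smul_eq_mul]
    rw [mul_assoc (x ^ i), mul_comm (x ^ i), inv_mul_cancel_left₀ hc]
  · intro y _
    convert h y using 1
    funext x
    rw [add_comm x, add_pow, Finset.sum_apply]
    refine Finset.sum_congr rfl fun t _ => ?_
    simp only [Pi.smul_apply, smul_eq_mul]
    ring

lemma V_mono_mem {m : ℕ} (hmq : m < Fintype.card F) (p : ℕ) [CharP F p] (i : ℕ)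
    (hi : ¬ p ∣ m.choose i) : (fun x : F => x ^ i) ∈ V F m := by
  refine shift_extract (V F m) m hmq (-1) (by simp) (fun y => ?_) p i hi
  refine Submodule.subset_span ⟨y, ?_⟩
  funext x
  ring

lemma V_coeff {m : ℕ} (hmq : m < Fintype.card F) (p : ℕ) [CharP F p] {φ : F → F}
    (hφ : φ ∈ V F m) (i : ℕ) (hi : p ∣ m.choose i) : (tp φ).coeff i = 0 := by
  induction hφ using Submodule.span_induction with
  | mem φ h =>
    obtain ⟨y, rfl⟩ := h
    have : tp (fun x : F => (x - y) ^ m) = (X + C (-y)) ^ m := by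
      refine tp_eq _ _ ?_ (by simp [sub_eq_add_neg])
      refine lt_of_le_of_lt natDegree_pow_le ?_
      rwa [natDegree_X_add_C, mul_one]
    rw [this, coeff_X_add_C_pow, (CharP.cast_eq_zero_iff F p _).2 hi, mul_zero]
  | zero => simp
  | add a b _ _ ha hb => rw [map_add, coeff_add, ha, hb, add_zero]
  | smul c a _ ha => rw [map_smul, coeff_smul, ha, smul_zero]

lemma V_deg {m : ℕ} (hmq : m < Fintype.card F) (p : ℕ) [CharP F p] {φ : F → F}
    (hφ : φ ∈ V F m) : (tp φ).natDegree ≤ m := by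
  rw [natDegree_le_iff_coeff_eq_zero]
  intro i hi
  refine V_coeff hmq p hφ i ?_
  rw [Nat.choose_eq_zero_of_lt hi]
  exact dvd_zero _

lemma W_le_V {m : ℕ} (hm : 0 < m) (hmq : m < Fintype.card F) (p : ℕ) [CharP F p]
    (hpm : ¬ p ∣ m) (hp1 : p ≠ 1) : W F m ≤ V F m := by
  refine Submodule.span_le.2 ?_
  rintro g (hg | hg)
  · have := V_comp hm hg (V_mono_mem hmq p 1 (by simpa using hpm))
    simpa using this
  · rw [Set.mem_singleton_iff] at hg
    have := V_mono_mem (F := F) hmq p 0 (by simpa using hp1)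
    simpa [hg] using this

lemma exists_H {m d : ℕ} (hdm : Fintype.card F - 1 = d * m) (hm : 0 < m) :
    ∃ H : Finset F, H.card = m ∧ ∀ h ∈ H, h ^ m = 1 := by
  classical
  obtain ⟨ζ, hζ⟩ := IsCyclic.exists_generator (α := Fˣ)
  have ho : orderOf ζ = d * m := by
    rw [orderOf_eq_card_of_forall_mem_zpowers hζ, Nat.card_eq_fintype_card, Fintype.card_units, hdm]
  have hd : d ≠ 0 := by
    rintro rfl
    have := orderOf_pos ζ
    simp [ho] at this
  have h1 : IsPrimitiveRoot (ζ : F) (d * m) := by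
    rw [← ho]
    exact IsPrimitiveRoot.coe_units_iff.2 (IsPrimitiveRoot.orderOf ζ)
  have h2 := h1.pow (Nat.mul_pos (Nat.pos_of_ne_zero hd) hm) rfl
  refine ⟨nthRootsFinset m (1 : F), h2.card_nthRootsFinset, fun h hh => ?_⟩
  exact (mem_nthRootsFinset hm 1).1 hh

/-- monomials of elements of `W` are in `W` -/
lemma W_mono {m d : ℕ} (hm : 0 < m) (hdm : Fintype.card F - 1 = d * m)
    {φ : F → F} (hφ : φ ∈ W F m) (hdeg : (tp φ).natDegree ≤ m) (j : ℕ)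
    (hj : (tp φ).coeff j ≠ 0) : (fun x : F => x ^ j) ∈ W F m := by
  classical
  obtain ⟨H, hH, hH1⟩ := exists_H (F := F) hdm hm
  have hc : ∀ c : F, (fun _ => c) ∈ W F m := fun c => by
    have := (W F m).smul_mem c one_mem_W
    convert this using 1
    funext x; simp
  have h0 : (0 : F) ∉ H := fun h => by
    have := hH1 0 h
    rw [zero_pow hm.ne'] at this
    exact zero_ne_one this
  have hjm : j ≤ m := (le_natDegree_of_ne_zero hj).trans hdeg
  have key := extract (W F m) (insert 0 H) m (by rw [Finset.card_insert_of_notMem h0, hH]; omega)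
    (fun t => fun x : F => (tp φ).coeff t * x ^ t) ?_ j hjm
  · have := (W F m).smul_mem ((tp φ).coeff j)⁻¹ key
    convert this using 1
    funext x
    simp [hj]
  · intro y hy
    rcases Finset.mem_insert.1 hy with rfl | hy
    · convert hc ((tp φ).coeff 0) using 1
      funext x
      rw [Finset.sum_apply, Finset.sum_eq_single 0]
      · simp
      · intro b _ hb
        simp [hb]
      · simp
    · have := W_comp (IsG.smul y (hH1 y hy)) hφ
      convert this using 1
      funext x
      rw [Finset.sum_apply, ← tp_eval φ, eval_eq_sum_range' (Nat.lt_succ_of_le hdeg)]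
      refine Finset.sum_congr rfl fun t _ => ?_
      simp only [Pi.smul_apply, smul_eq_mul]
      ring


structure Ctx (F : Type*) [Field F] [Fintype F] (p n d m : ℕ) : Prop where
  hp : p.Prime
  hn : 0 < n
  hF : Fintype.card F = p ^ n
  hd : 1 < d
  hdm : p ^ n - 1 = d * m

namespace Ctx
variable {p n d m : ℕ}

lemma two_le (h : Ctx F p n d m) : 2 ≤ p ^ n :=
  h.hp.two_le.trans (Nat.le_self_pow h.hn.ne' p)

lemma m_pos (h : Ctx F p n d m) : 0 < m := by
  have h1 := h.two_le
  have h2 := h.hdm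
  rcases Nat.eq_zero_or_pos m with rfl | h3
  · simp at h2; omega
  · exact h3

lemma two_m (h : Ctx F p n d m) : 2 * m < p ^ n := by
  have h1 := h.two_le
  have h2 := h.hdm
  have h3 : 2 * m ≤ d * m := Nat.mul_le_mul_right _ h.hd
  omega

lemma hdm' (h : Ctx F p n d m) : Fintype.card F - 1 = d * m := by rw [h.hF, h.hdm]

lemma m_lt (h : Ctx F p n d m) : m < Fintype.card F := by
  have := h.two_m
  rw [h.hF]; omega

lemma not_dvd (h : Ctx F p n d m) : ¬ p ∣ m := by
  intro hm
  have h1 : p ∣ p ^ n - 1 := h.hdm ▸ hm.mul_left d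
  have h2 : p ∣ p ^ n := dvd_pow_self p h.hn.ne'
  have h3 := (Nat.dvd_sub_iff_right (by have := h.two_le; omega) h2).1 h1
  exact h.hp.one_lt.ne' (Nat.dvd_one.1 h3)

lemma char (h : Ctx F p n d m) : CharP F p := by
  have := Fact.mk h.hp
  obtain ⟨r, hr⟩ := CharP.exists F
  obtain ⟨k, hr', hk⟩ := FiniteField.card F r
  have : r ∣ p ^ n := by
    rw [← h.hF, hk]
    exact dvd_pow_self r k.ne_zero
  have := (Nat.prime_dvd_prime_iff_eq hr' h.hp).1 (hr'.dvd_of_dvd_pow this)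
  exact this ▸ hr

lemma W_V (h : Ctx F p n d m) : W F m ≤ V F m := by
  have := h.char
  exact W_le_V h.m_pos h.m_lt p h.not_dvd h.hp.one_lt.ne'

lemma W_deg (h : Ctx F p n d m) {φ : F → F} (hφ : φ ∈ W F m) : (tp φ).natDegree ≤ m := by
  have := h.char
  exact V_deg h.m_lt p (h.W_V hφ)

lemma mono (h : Ctx F p n d m) {φ : F → F} (hφ : φ ∈ W F m) (j : ℕ)
    (hj : (tp φ).coeff j ≠ 0) : (fun x : F => x ^ j) ∈ W F m :=
  W_mono h.m_pos h.hdm' hφ (h.W_deg hφ) j hj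

lemma pow_comp {g : F → F} (hg : IsG m g) {j : ℕ} (hj : (fun x : F => x ^ j) ∈ W F m) :
    (fun x => g x ^ j) ∈ W F m := W_comp hg hj

lemma add_frob (h : Ctx F p n d m) (b : ℕ) (x y : F) :
    (x + y) ^ p ^ b = x ^ p ^ b + y ^ p ^ b := by
  have := h.char
  have := Fact.mk h.hp
  exact add_pow_char_pow x y p b

lemma frob_inj (h : Ctx F p n d m) (b : ℕ) {x y : F} (hxy : x ^ p ^ b = y ^ p ^ b) : x = y := by
  have := h.char
  have := Fact.mk h.hp
  exact iterateFrobenius_inj F p b (by simpa [iterateFrobenius_def] using hxy)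

lemma frob_mem (h : Ctx F p n d m) (b : ℕ) (hb : (fun x : F => x ^ p ^ b) ∈ W F m)
    {φ : F → F} (hφ : φ ∈ W F m) : (fun x => φ x ^ p ^ b) ∈ W F m := by
  have hpb : p ^ b ≠ 0 := pow_ne_zero _ h.hp.ne_zero
  induction hφ using Submodule.span_induction with
  | mem φ hφ =>
    rcases hφ with hφ | hφ
    · exact pow_comp hφ hb
    · rw [Set.mem_singleton_iff] at hφ
      subst hφ
      simpa using one_mem_W
  | zero =>
    simp only [Pi.zero_apply, zero_pow hpb]
    exact (W F m).zero_mem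
  | add u v _ _ hu hv =>
    simp only [Pi.add_apply, h.add_frob b]
    exact (W F m).add_mem hu hv
  | smul c u _ hu =>
    simp only [Pi.smul_apply, smul_eq_mul, mul_pow]
    exact (W F m).smul_mem (c ^ p ^ b) hu

lemma frob_surj (h : Ctx F p n d m) (b : ℕ) (hb : (fun x : F => x ^ p ^ b) ∈ W F m)
    {φ : F → F} (hφ : φ ∈ W F m) : ∃ ψ ∈ W F m, ∀ x, ψ x ^ p ^ b = φ x := by
  let T : W F m → W F m := fun u => ⟨fun x => u.1 x ^ p ^ b, h.frob_mem b hb u.2⟩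
  have hT : Function.Injective T := by
    intro u v huv
    apply Subtype.ext
    funext x
    exact h.frob_inj b (congrFun (congrArg Subtype.val huv) x)
  obtain ⟨ψ, hψ⟩ := (Finite.injective_iff_surjective.1 hT) ⟨φ, hφ⟩
  exact ⟨ψ.1, ψ.2, fun x => congrFun (congrArg Subtype.val hψ) x⟩

/-- Some `g` in the group has `x ^ j` occurring in `g ^ (p ^ b)`. -/
lemma exists_g (h : Ctx F p n d m) (b : ℕ) (hb : (fun x : F => x ^ p ^ b) ∈ W F m)
    (j : ℕ) (hj0 : j ≠ 0) (hjm : j ≤ m) (hj : (fun x : F => x ^ j) ∈ W F m) :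
    ∃ g : F → F, IsG m g ∧ (tp (fun x => g x ^ p ^ b)).coeff j ≠ 0 := by
  by_contra hc
  push Not at hc
  have hpb : p ^ b ≠ 0 := pow_ne_zero _ h.hp.ne_zero
  have key : ∀ φ ∈ W F m, (tp (fun x => φ x ^ p ^ b)).coeff j = 0 := by
    intro φ hφ
    induction hφ using Submodule.span_induction with
    | mem φ hφ =>
      rcases hφ with hφ | hφ
      · exact hc φ hφ
      · rw [Set.mem_singleton_iff] at hφ
        subst hφ
        simp only [one_pow]
        rw [tp_const, coeff_C, if_neg hj0]
    | zero =>
      have : (fun x : F => (0 : F → F) x ^ p ^ b) = 0 := by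
        funext x
        simp only [Pi.zero_apply, zero_pow hpb]
      rw [this]; simp
    | add u v _ _ hu hv =>
      simp only [Pi.add_apply, h.add_frob b]
      have := map_add tp (fun x => u x ^ p ^ b) (fun x => v x ^ p ^ b)
      have h2 := congrArg (fun P => coeff P j) this
      simp only [coeff_add, hu, hv, add_zero] at h2
      exact h2
    | smul c u _ hu =>
      simp only [Pi.smul_apply, smul_eq_mul, mul_pow]
      have := map_smul tp (c ^ p ^ b) (fun x => u x ^ p ^ b)
      have h2 := congrArg (fun P => coeff P j) this
      simp only [coeff_smul, hu, smul_zero] at h2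
      exact h2
  obtain ⟨ψ, hψ, hψ2⟩ := h.frob_surj b hb hj
  have := key ψ hψ
  simp only [hψ2] at this
  rw [tp_pow j (hjm.trans_lt h.m_lt), coeff_X_pow, if_pos rfl] at this
  exact one_ne_zero this

lemma W_sub (h : Ctx F p n d m) (j i : ℕ) (hjm : j ≤ m) (hj : (fun x : F => x ^ j) ∈ W F m)
    (hi : ¬ p ∣ j.choose i) : (fun x : F => x ^ i) ∈ W F m := by
  have := h.char
  refine shift_extract (W F m) j (hjm.trans_lt h.m_lt) 1 one_ne_zero (fun y => ?_) p i hi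
  rw [one_mul]
  exact W_comp (IsG.add y) hj

/-- all exponents in `W` are powers of `p` -/
lemma pow_p (h : Ctx F p n d m) (j : ℕ) (hj0 : j ≠ 0) (hjm : j ≤ m)
    (hj : (fun x : F => x ^ j) ∈ W F m) : j = p ^ Nat.log p j := by
  classical
  by_contra hne
  set b := Nat.log p j with hb
  have hlt : p ^ b < j := lt_of_le_of_ne (Nat.pow_log_le_self p hj0) (Ne.symm hne)
  have hl : ¬ p ∣ j.choose (p ^ b) := lucas_log h.hp j hj0
  have hbW := h.W_sub j (p ^ b) hjm hj hl
  have h2W := h.W_sub j (j - p ^ b) hjm hj (by rwa [Nat.choose_symm hlt.le])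
  -- the maximal exponent
  let J := (Finset.range (m + 1)).filter (fun t => (fun x : F => x ^ t) ∈ W F m)
  have hJ : J.Nonempty := ⟨j, Finset.mem_filter.2 ⟨Finset.mem_range.2 (by omega), hj⟩⟩
  obtain ⟨heR, heW⟩ := Finset.mem_filter.1 (J.max'_mem hJ)
  set e := J.max' hJ with he
  have hmax : ∀ t, t ≤ m → (fun x : F => x ^ t) ∈ W F m → t ≤ e := fun t ht htW =>
    J.le_max' t (Finset.mem_filter.2 ⟨Finset.mem_range.2 (by omega), htW⟩)
  have hem : e ≤ m := by have := Finset.mem_range.1 heR; omega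
  have he0 : e ≠ 0 := by have := hmax j hjm hj; omega
  have hdeg : ∀ φ ∈ W F m, (tp φ).natDegree ≤ e := by
    intro φ hφ
    rw [natDegree_le_iff_coeff_eq_zero]
    intro i hi
    by_contra hci
    have h1 := (le_natDegree_of_ne_zero hci).trans (h.W_deg hφ)
    have := hmax i h1 (h.mono hφ i hci)
    omega
  obtain ⟨g, hg, hge⟩ := h.exists_g b hbW e he0 hem heW
  have hP1 : (tp (fun x => g x ^ p ^ b)).natDegree = e :=
    le_antisymm (hdeg _ (pow_comp hg hbW)) (le_natDegree_of_ne_zero hge)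
  have hP2 : (tp (fun x => g x ^ (j - p ^ b))).natDegree ≤ e := hdeg _ (pow_comp hg h2W)
  have hP20 : (tp (fun x => g x ^ (j - p ^ b))).natDegree ≠ 0 := by
    intro h0
    obtain ⟨c, hc⟩ := natDegree_eq_zero.1 h0
    have hev : ∀ x, g x ^ (j - p ^ b) = c := fun x => by
      have := tp_eval (fun x => g x ^ (j - p ^ b)) x
      rw [← hc, eval_C] at this
      exact this.symm
    obtain ⟨x0, hx0⟩ := hg.surj h.m_pos 0
    obtain ⟨x1, hx1⟩ := hg.surj h.m_pos 1
    have e0 := hev x0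
    have e1 := hev x1
    rw [hx0, zero_pow (by omega)] at e0
    rw [hx1, one_pow] at e1
    exact zero_ne_one (e0.trans e1.symm)
  have h2m := h.two_m
  have hmul := tp_mul (fun x => g x ^ p ^ b) (fun x => g x ^ (j - p ^ b))
    (by rw [h.hF]; omega)
  have hfun : (fun x => g x ^ p ^ b * g x ^ (j - p ^ b)) = fun x => g x ^ j := by
    funext x
    rw [← pow_add]; congr 1; omega
  rw [hfun] at hmul
  have hfin := hdeg _ (pow_comp hg hj)
  rw [hmul, natDegree_mul (fun h0 => by rw [h0] at hge; simp at hge)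
    (fun h0 => by rw [h0] at hP20; simp at hP20)] at hfin
  omega

lemma pow_card (h : Ctx F p n d m) (x : F) : x ^ p ^ n = x := by
  rw [← h.hF]; exact FiniteField.pow_card x

lemma S_add (h : Ctx F p n d m) {k l : ℕ} (hk : (fun x : F => x ^ p ^ k) ∈ W F m)
    (hl : (fun x : F => x ^ p ^ l) ∈ W F m) : (fun x : F => x ^ p ^ (k + l)) ∈ W F m := by
  have := h.frob_mem l hl hk
  simpa [← pow_mul, ← pow_add] using this

lemma S_sub (h : Ctx F p n d m) {k l : ℕ} (hk : (fun x : F => x ^ p ^ (k + l)) ∈ W F m)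
    (hl : (fun x : F => x ^ p ^ l) ∈ W F m) : (fun x : F => x ^ p ^ k) ∈ W F m := by
  obtain ⟨ψ, hψ, hψ2⟩ := h.frob_surj l hl hk
  convert hψ using 1
  funext x
  refine h.frob_inj l ?_
  rw [hψ2, ← pow_mul, ← pow_add]

lemma S_n (h : Ctx F p n d m) : (fun x : F => x ^ p ^ n) ∈ W F m := by
  simp only [h.pow_card]
  exact G_mem_W IsG.id

lemma S_gen (h : Ctx F p n d m) : ∃ a, 0 < a ∧
    ∀ k, ((fun x : F => x ^ p ^ k) ∈ W F m ↔ a ∣ k) := by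
  classical
  have hex : ∃ a, 0 < a ∧ (fun x : F => x ^ p ^ a) ∈ W F m := ⟨n, h.hn, h.S_n⟩
  obtain ⟨ha0, haW⟩ := Nat.find_spec hex
  set a := Nat.find hex with ha
  have hmul : ∀ c, (fun x : F => x ^ p ^ (a * c)) ∈ W F m := by
    intro c
    induction c with
    | zero => simpa using G_mem_W IsG.id
    | succ c ih => exact h.S_add ih haW
  refine ⟨a, ha0, fun k => ⟨fun hk => ?_, ?_⟩⟩
  · have h1 : (fun x : F => x ^ p ^ (k % a)) ∈ W F m := by
      refine h.S_sub (l := a * (k / a)) ?_ (hmul _)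
      rwa [Nat.mod_add_div]
    refine Nat.dvd_of_mod_eq_zero ?_
    by_contra hne
    exact Nat.find_min hex (Nat.mod_lt k ha0) ⟨Nat.pos_of_ne_zero hne, h1⟩
  · rintro ⟨c, rfl⟩
    exact hmul c

end Ctx

namespace Ctx
variable {p n d m : ℕ}

lemma coeffs (h : Ctx F p n d m) {a : ℕ}
    (hS : ∀ k, ((fun x : F => x ^ p ^ k) ∈ W F m ↔ a ∣ k)) {φ : F → F} (hφ : φ ∈ W F m)
    (i : ℕ) (hi0 : i ≠ 0) (hi : (tp φ).coeff i ≠ 0) :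
    ∃ k, i = p ^ k ∧ a ∣ k ∧ k + a ≤ n := by
  have h1 := h.mono hφ i hi
  have h2 := (le_natDegree_of_ne_zero hi).trans (h.W_deg hφ)
  have h3 := h.pow_p i hi0 h2 h1
  have han : a ∣ n := (hS n).1 h.S_n
  refine ⟨Nat.log p i, h3, ?_, ?_⟩
  · rw [← hS, ← h3]; exact h1
  · have hak : a ∣ Nat.log p i := by rw [← hS, ← h3]; exact h1
    have hlt : Nat.log p i < n := by
      refine (Nat.pow_lt_pow_iff_right h.hp.one_lt).1 ?_
      rw [← h3]
      have := h.two_m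
      omega
    have := Nat.le_of_dvd (by omega) (Nat.dvd_sub han hak)
    omega

lemma E_le (h : Ctx F p n d m) {a : ℕ} (ha : 0 < a)
    (hS : ∀ k, ((fun x : F => x ^ p ^ k) ∈ W F m ↔ a ∣ k)) : p ^ (n - a) ≤ m := by
  have han : a ∣ n := (hS n).1 h.S_n
  have h1 := (hS (n - a)).2 (Nat.dvd_sub han dvd_rfl)
  have h2 := h.W_deg h1
  rw [tp_pow, natDegree_X_pow] at h2
  · exact h2
  · rw [h.hF]
    have := h.hn
    exact Nat.pow_lt_pow_right h.hp.one_lt (by omega)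

lemma deg_le (h : Ctx F p n d m) {a : ℕ}
    (hS : ∀ k, ((fun x : F => x ^ p ^ k) ∈ W F m ↔ a ∣ k)) {φ : F → F} (hφ : φ ∈ W F m) :
    (tp φ).natDegree ≤ p ^ (n - a) := by
  rw [natDegree_le_iff_coeff_eq_zero]
  intro i hi
  by_contra hne
  obtain ⟨k, rfl, _, hk⟩ := h.coeffs hS hφ i (by omega) hne
  have : p ^ k ≤ p ^ (n - a) := Nat.pow_le_pow_right h.hp.pos (by omega)
  omega

lemma mu_lt (h : Ctx F p n d m) {a : ℕ} (han : a ≤ n) : m / p ^ (n - a) < p ^ a := by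
  rw [Nat.div_lt_iff_lt_mul (pow_pos h.hp.pos _), ← pow_add]
  have := h.two_m
  rw [show a + (n - a) = n by omega]
  omega

lemma mu_choose (h : Ctx F p n d m) {a : ℕ} (ha : 0 < a)
    (hS : ∀ k, ((fun x : F => x ^ p ^ k) ∈ W F m ↔ a ∣ k)) (k : ℕ) (hak : a ∣ k)
    (hk : k + a ≤ n) : ¬ p ∣ m.choose (p ^ k * (m / p ^ (n - a))) := by
  have := h.char
  have han : a ∣ n := (hS n).1 h.S_n
  have hE := h.E_le ha hS
  have hcW := (hS (n - a)).2 (Nat.dvd_sub han dvd_rfl)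
  have hmu := h.mu_lt (a := a) (by omega)
  set μ := m / p ^ (n - a) with hμ
  have hμm : μ * p ^ (n - a) ≤ m := Nat.div_mul_le_self _ _
  obtain ⟨g, hg, hgc⟩ := h.exists_g (n - a) hcW (p ^ k) (pow_ne_zero _ h.hp.ne_zero)
    ((Nat.pow_le_pow_right h.hp.pos (by omega)).trans hE) ((hS k).2 hak)
  have hgW : (fun x => g x ^ p ^ (n - a)) ∈ W F m := pow_comp hg hcW
  have hV : (fun x => (g x ^ p ^ (n - a)) ^ μ) ∈ V F m := by
    have := V_comp h.m_pos hg (V_mono_mem h.m_lt p _ (lucas_top h.hp m (n - a)))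
    simpa only [pow_mul] using this
  have htp := tp_powf (fun x => g x ^ p ^ (n - a)) μ (by
    have h1 := Nat.mul_le_mul_left μ (h.deg_le hS hgW)
    have := h.m_lt
    omega)
  intro hdvd
  have h0 := V_coeff h.m_lt p hV _ hdvd
  rw [htp] at h0
  have hco := h.coeffs hS hgW
  set P := tp (fun x => g x ^ p ^ (n - a)) with hP
  set L := P %ₘ (X ^ p ^ (k + a)) with hL
  have hmon : (X ^ p ^ (k + a) : F[X]).Monic := monic_X_pow _
  have hsplit : P - L = X ^ p ^ (k + a) * (P /ₘ (X ^ p ^ (k + a))) := by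
    rw [sub_eq_iff_eq_add, add_comm]
    exact (modByMonic_add_div P _).symm
  have hLc : ∀ i, i < p ^ (k + a) → L.coeff i = P.coeff i := by
    intro i hi
    have := congrArg (fun R => coeff R i) hsplit
    simp only [coeff_sub, coeff_X_pow_mul', if_neg (not_le.2 hi)] at this
    exact (sub_eq_zero.1 this).symm
  have hklt : p ^ k < p ^ (k + a) := Nat.pow_lt_pow_right h.hp.one_lt (by omega)
  have hLd : L.natDegree ≤ p ^ k := by
    rw [natDegree_le_iff_coeff_eq_zero]
    intro i hi
    rcases lt_or_ge i (p ^ (k + a)) with hlt | hge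
    · rw [hLc i hlt]
      by_contra hne
      obtain ⟨s, rfl, has, _⟩ := hco i (by omega) hne
      have h1 := (Nat.pow_lt_pow_iff_right h.hp.one_lt).1 hi
      have h2 := (Nat.pow_lt_pow_iff_right h.hp.one_lt).1 hlt
      have := Nat.le_of_dvd (by omega) (Nat.dvd_sub has hak)
      omega
    · refine coeff_eq_zero_of_degree_lt ?_
      refine (degree_modByMonic_lt P hmon).trans_le ?_
      rw [degree_X_pow]
      exact_mod_cast hge
  obtain ⟨R, hR⟩ := sub_dvd_pow_sub_pow P L μ
  rw [hsplit, mul_assoc] at hR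
  have hlt : p ^ k * μ < p ^ (k + a) := by
    rw [pow_add]
    exact Nat.mul_lt_mul_of_pos_left hmu (pow_pos h.hp.pos k)
  have h1 := congrArg (fun R => coeff R (p ^ k * μ)) hR
  simp only [coeff_sub, coeff_X_pow_mul', if_neg (not_le.2 hlt)] at h1
  rw [h0, zero_sub, neg_eq_zero, mul_comm, coeff_pow_of_natDegree_le hLd, hLc _ hklt] at h1
  exact hgc (eq_zero_of_pow_eq_zero h1)

lemma expand (h : Ctx F p n d m) {a : ℕ} (ha : 0 < a)
    (hS : ∀ k, ((fun x : F => x ^ p ^ k) ∈ W F m ↔ a ∣ k)) {φ : F → F} (hφ : φ ∈ W F m) :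
    tp φ = C ((tp φ).coeff 0) + ∑ s ∈ Finset.range n, C ((tp φ).coeff (p ^ s)) * X ^ p ^ s := by
  ext i
  simp only [coeff_add, finsetSum_coeff, coeff_C_mul_X_pow, coeff_C]
  by_cases hi0 : i = 0
  · subst hi0
    rw [Finset.sum_eq_zero]
    · simp
    · intro s _
      rw [if_neg (pow_ne_zero _ h.hp.ne_zero).symm]
  rw [if_neg hi0, zero_add]
  by_cases hi : (tp φ).coeff i = 0
  · rw [hi, Finset.sum_eq_zero]
    intro s _
    split_ifs with hs
    · rw [← hs, hi]
    · rfl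
  · obtain ⟨k, rfl, _, hk⟩ := h.coeffs hS hφ i hi0 hi
    rw [Finset.sum_eq_single k]
    · simp
    · intro s _ hs
      rw [if_neg]
      intro he
      exact hs (Nat.pow_right_injective h.hp.two_le he).symm
    · intro hk'
      exact absurd (Finset.mem_range.2 (by omega)) hk'

lemma sum_frob (h : Ctx F p n d m) (b : ℕ) (s : Finset ℕ) (u : ℕ → F) :
    (∑ i ∈ s, u i) ^ p ^ b = ∑ i ∈ s, u i ^ p ^ b := by
  have := h.char
  have := Fact.mk h.hp
  exact sum_pow_char_pow p b s u

lemma frob_coeff (h : Ctx F p n d m) {a : ℕ} (ha : 0 < a)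
    (hS : ∀ k, ((fun x : F => x ^ p ^ k) ∈ W F m ↔ a ∣ k)) {φ : F → F} (hφ : φ ∈ W F m)
    (k b : ℕ) (hkb : k + b < n) :
    (tp (fun x => φ x ^ p ^ b)).coeff (p ^ (k + b)) = (tp φ).coeff (p ^ k) ^ p ^ b := by
  have hex := h.expand ha hS hφ
  set P := tp φ with hP
  have hval : ∀ x, φ x = P.coeff 0 + ∑ s ∈ Finset.range n, P.coeff (p ^ s) * x ^ p ^ s := by
    intro x
    have h1 := tp_eval φ x
    rw [← hP, hex] at h1
    rw [← h1]
    simp [eval_finsetSum]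
  have htp : tp (fun x => φ x ^ p ^ b) = C (P.coeff 0 ^ p ^ b) +
      ∑ s ∈ Finset.range n, C (P.coeff (p ^ s) ^ p ^ b) * X ^ p ^ ((s + b) % n) := by
    refine tp_eq _ _ ?_ ?_
    · rw [h.hF]
      refine lt_of_le_of_lt (b := p ^ (n - 1)) ?_
        (Nat.pow_lt_pow_right h.hp.one_lt (by omega))
      refine natDegree_add_le_of_degree_le (by simp) ?_
      refine natDegree_sum_le_of_forall_le _ _ fun s _ => ?_
      refine (natDegree_C_mul_X_pow_le _ _).trans ?_
      refine Nat.pow_le_pow_right h.hp.pos ?_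
      have := Nat.mod_lt (s + b) h.hn
      omega
    · intro x
      rw [hval x, h.add_frob, h.sum_frob]
      simp only [eval_add, eval_C, eval_finsetSum, eval_mul, eval_pow, eval_X]
      congr 1
      refine Finset.sum_congr rfl fun s _ => ?_
      rw [mul_pow, ← pow_mul, ← pow_add]
      congr 1
      conv_rhs => rw [← Nat.div_add_mod (s + b) n]
      generalize (s + b) / n = t
      generalize (s + b) % n = r
      induction t with
      | zero => simp
      | succ t ih =>
        rw [ih, show n * (t + 1) + r = n + (n * t + r) by ring, pow_add p n, pow_mul, h.pow_card]
  rw [htp]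
  simp only [coeff_add, finsetSum_coeff, coeff_C_mul_X_pow, coeff_C]
  rw [if_neg (pow_ne_zero _ h.hp.ne_zero), zero_add, Finset.sum_eq_single k]
  · rw [Nat.mod_eq_of_lt hkb, if_pos rfl]
  · intro s hs hsk
    rw [if_neg]
    intro he
    have he' := Nat.pow_right_injective h.hp.two_le he
    have hs' := Finset.mem_range.1 hs
    rcases lt_or_ge (s + b) n with hlt | hge
    · rw [Nat.mod_eq_of_lt hlt] at he'
      omega
    · rw [Nat.mod_eq_sub_mod hge, Nat.mod_eq_of_lt (by omega)] at he'
      omega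
  · intro hk'
    exact absurd (Finset.mem_range.2 (by omega)) hk'

/-- only one non-constant monomial can occur -/
lemma unique_mono (h : Ctx F p n d m) {a : ℕ} (ha : 0 < a)
    (hS : ∀ k, ((fun x : F => x ^ p ^ k) ∈ W F m ↔ a ∣ k)) {f : F → F} (hf : IsG m f)
    (k l : ℕ) (hkl : k < l) (hk : (tp f).coeff (p ^ k) ≠ 0) (hl : (tp f).coeff (p ^ l) ≠ 0) :
    False := by
  have := h.char
  have hfW := G_mem_W hf
  have han : a ∣ n := (hS n).1 h.S_n
  have hinj := Nat.pow_right_injective h.hp.two_le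
  obtain ⟨k', hk1, hak, hkn⟩ := h.coeffs hS hfW _ (pow_ne_zero _ h.hp.ne_zero) hk
  obtain rfl := hinj hk1
  obtain ⟨l', hl1, hal, hln⟩ := h.coeffs hS hfW _ (pow_ne_zero _ h.hp.ne_zero) hl
  obtain rfl := hinj hl1
  have hac : a ∣ n - a := Nat.dvd_sub han dvd_rfl
  have hE := h.E_le ha hS
  have hE0 : 0 < p ^ (n - a) := pow_pos h.hp.pos _
  have hmu := h.mu_lt (a := a) (by omega)
  have key : ∀ t, a ∣ t → t + a ≤ n → (tp f).coeff (p ^ t) ≠ 0 →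
      (tp (fun x => f x ^ p ^ (n - a - t))).natDegree = p ^ (n - a) := by
    intro t hat htn hct
    have hW : (fun x => f x ^ p ^ (n - a - t)) ∈ W F m :=
      pow_comp hf ((hS _).2 (Nat.dvd_sub hac hat))
    refine le_antisymm (h.deg_le hS hW) (le_natDegree_of_ne_zero ?_)
    have := h.frob_coeff ha hS hfW t (n - a - t) (by omega)
    rw [show t + (n - a - t) = n - a by omega] at this
    rw [this]
    exact pow_ne_zero _ hct
  have hP1 := key k hak hkn hk
  have hP2 := key l hal hln hl
  have hc1 := h.mu_choose ha hS (n - a - k) (Nat.dvd_sub hac hak) (by omega)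
  have hc2 := h.mu_choose ha hS (n - a - l) (Nat.dvd_sub hac hal) (by omega)
  have hmpos : 1 ≤ m / p ^ (n - a) := Nat.div_pos hE hE0
  have hm1 : m / p ^ (n - a) * p ^ (n - a) ≤ m := Nat.div_mul_le_self _ _
  have hm2 : m < (m / p ^ (n - a) + 1) * p ^ (n - a) := by
    rw [mul_comm]; exact Nat.lt_mul_div_succ m hE0
  set μ := m / p ^ (n - a) with hμ
  have hm3 : m < μ * p ^ (n - a) + μ * p ^ (n - a) := by nlinarith
  have h2m := h.two_m
  have hlt : p ^ (n - a - l) * μ < p ^ (n - a - k) := by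
    calc p ^ (n - a - l) * μ < p ^ (n - a - l) * p ^ a :=
          Nat.mul_lt_mul_of_pos_left hmu (pow_pos h.hp.pos _)
      _ = p ^ (n - a - l + a) := (pow_add _ _ _).symm
      _ ≤ p ^ (n - a - k) := by
          refine Nat.pow_le_pow_right h.hp.pos ?_
          have := Nat.le_of_dvd (by omega) (Nat.dvd_sub hal hak)
          omega
  have hsum := lucas_sum h.hp m (n - a - k) _ μ hlt hc2 hc1
  have hV := V_comp h.m_pos hf (V_mono_mem h.m_lt p _ hsum)
  have hfun : (fun x => f x ^ (p ^ (n - a - l) * μ + p ^ (n - a - k) * μ)) =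
      fun x => (f x ^ p ^ (n - a - l)) ^ μ * (f x ^ p ^ (n - a - k)) ^ μ := by
    funext x
    rw [pow_add, pow_mul, pow_mul]
  rw [hfun] at hV
  have hdeg := V_deg h.m_lt p hV
  have t1 := tp_powf (fun x => f x ^ p ^ (n - a - l)) μ (by rw [hP2, h.hF]; omega)
  have t2 := tp_powf (fun x => f x ^ p ^ (n - a - k)) μ (by rw [hP1, h.hF]; omega)
  have d1 : (tp (fun x => (f x ^ p ^ (n - a - l)) ^ μ)).natDegree = μ * p ^ (n - a) := by
    rw [t1, natDegree_pow, hP2]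
  have d2 : (tp (fun x => (f x ^ p ^ (n - a - k)) ^ μ)).natDegree = μ * p ^ (n - a) := by
    rw [t2, natDegree_pow, hP1]
  have hpos : 0 < μ * p ^ (n - a) := Nat.mul_pos hmpos hE0
  rw [tp_mul _ _ (by rw [d1, d2, h.hF]; omega), natDegree_mul
    (fun h0 => by rw [h0, natDegree_zero] at d1; omega)
    (fun h0 => by rw [h0, natDegree_zero] at d2; omega), d1, d2] at hdeg
  omega

lemma final (h : Ctx F p n d m) {f : F → F} (hf : IsG m f) (h0 : f 0 = 0) (h1 : f 1 = 1) :
    ∃ j, j < n ∧ d ∣ p ^ j - 1 ∧ ∀ x : F, f x = x ^ p ^ j := by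
  obtain ⟨a, ha, hS⟩ := h.S_gen
  have hfW := G_mem_W hf
  have hex := h.expand ha hS hfW
  have hc0 : (tp f).coeff 0 = 0 := by
    rw [coeff_zero_eq_eval_zero, tp_eval, h0]
  have hval : ∀ x, f x = ∑ s ∈ Finset.range n, (tp f).coeff (p ^ s) * x ^ p ^ s := by
    intro x
    have h2 := tp_eval f x
    rw [hex, hc0] at h2
    rw [← h2]
    simp [eval_finsetSum]
  have hk : ∃ k ∈ Finset.range n, (tp f).coeff (p ^ k) ≠ 0 := by
    by_contra hc
    push Not at hc
    have := hval 1
    rw [Finset.sum_eq_zero (fun s hs => by rw [hc s hs, zero_mul]), h1] at this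
    exact one_ne_zero this
  obtain ⟨k, hkn, hk⟩ := hk
  have hval2 : ∀ x, f x = (tp f).coeff (p ^ k) * x ^ p ^ k := by
    intro x
    rw [hval x, Finset.sum_eq_single k]
    · intro s _ hs
      have : (tp f).coeff (p ^ s) = 0 := by
        by_contra hne
        rcases lt_or_gt_of_ne hs with hlt | hlt
        · exact h.unique_mono ha hS hf s k hlt hne hk
        · exact h.unique_mono ha hS hf k s hlt hk hne
      rw [this, zero_mul]
    · intro hc; exact absurd hkn hc
  have hone : (tp f).coeff (p ^ k) = 1 := by
    have := hval2 1
    rw [h1, one_pow, mul_one] at this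
    exact this.symm
  have hval3 : ∀ x, f x = x ^ p ^ k := fun x => by rw [hval2 x, hone, one_mul]
  refine ⟨k, Finset.mem_range.1 hkn, ?_, hval3⟩
  obtain ⟨ζ, hζ⟩ := IsCyclic.exists_generator (α := Fˣ)
  have ho : orderOf ζ = d * m := by
    classical
    rw [orderOf_eq_card_of_forall_mem_zpowers hζ, Nat.card_eq_fintype_card, Fintype.card_units,
      h.hdm']
  have he := hf (ζ : F) 0
  rw [h0, sub_zero, sub_zero, hval3, ← pow_mul] at he
  have he2 : ζ ^ (p ^ k * m) = ζ ^ m := Units.ext (by simpa using he)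
  have hmod := pow_eq_pow_iff_modEq.1 he2
  rw [ho] at hmod
  have hle : 1 ≤ p ^ k := Nat.one_le_pow _ _ h.hp.pos
  have hdv := (Nat.modEq_iff_dvd' (Nat.le_mul_of_pos_left m hle)).1 hmod.symm
  rw [show p ^ k * m - m = (p ^ k - 1) * m by rw [Nat.sub_mul, one_mul]] at hdv
  exact Nat.dvd_of_mul_dvd_mul_right h.m_pos hdv

end Ctx

end CMc

theorem stmt17 (p n d m : ℕ) (hp : Nat.Prime p) (hn : 0 < n)
    (F : Type*) [Field F] [Fintype F] (hF : Fintype.card F = p ^ n)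
    (hd : 1 < d) (hdm : p ^ n - 1 = d * m)
    (f : F → F) (hbij : Function.Bijective f) (h0 : f 0 = 0) (h1 : f 1 = 1)
    (hΨ : ∀ x y : F, (f x - f y) ^ m = (x - y) ^ m) :
    ∃ j, j < n ∧ d ∣ p ^ j - 1 ∧ ∀ x : F, f x = x ^ p ^ j := by
  exact CMc.Ctx.final ⟨hp, hn, hF, hd, hdm⟩ hΨ h0 h1
end
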